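/- Over the 3-periodic billiard family, the circumcenter X₃† of the focus-inversive triangle lies on the circle with center C₃† = (−c(1 + ρ²(a² + b²)/(2b⁴)), 0) and radius R₃† = ρ² a(δ − b²)/(2b⁴). -/

import Mathlib

noncomputable section

namespace BilliardInv

/-- A point of the plane. -/
abbrev Pt := ℝ × ℝ

/-- Euclidean dot product. -/
def dot (p q : Pt) : ℝ := p.1 * q.1 + p.2 * q.2

/-- Euclidean distance. -/
def dst (p q : Pt) : ℝ := Real.sqrt ((p.1 - q.1) ^ 2 + (p.2 - q.2) ^ 2)

/-- Membership in the ellipse x²/a² + y²/b² = 1. -/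
def onEllipse (a b : ℝ) (p : Pt) : Prop := p.1 ^ 2 / a ^ 2 + p.2 ^ 2 / b ^ 2 = 1

/-- Half the gradient of f(x,y) = x²/a² + y²/b² (an outward normal direction). -/
def nrm (a b : ℝ) (p : Pt) : Pt := (p.1 / a ^ 2, p.2 / b ^ 2)

/-- Unit vector pointing from `v` toward `q`. -/
def udir (v q : Pt) : Pt := (dst v q)⁻¹ • (q - v)

/-- The billiard reflection law at vertex `v` with neighboring vertices `q`, `r`:
the two adjacent sides make equal angles with the ellipse normal at `v`. -/
def reflectAt (a b : ℝ) (q v r : Pt) : Prop :=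
  dot (udir v q) (nrm a b v) = dot (udir v r) (nrm a b v)

/-- A 3-periodic billiard orbit in the ellipse with semi-axes `a > b > 0`:
a nondegenerate triangle inscribed in the ellipse obeying the reflection
law at each vertex. -/
structure Orbit3 (a b : ℝ) : Type where
  P1 : Pt
  P2 : Pt
  P3 : Pt
  h1 : onEllipse a b P1
  h2 : onEllipse a b P2
  h3 : onEllipse a b P3
  d12 : P1 ≠ P2
  d23 : P2 ≠ P3
  d31 : P3 ≠ P1
  r1 : reflectAt a b P3 P1 P2
  r2 : reflectAt a b P1 P2 P3
  r3 : reflectAt a b P2 P3 P1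

/-- Inversion of `p` with respect to the circle of radius `ρ` centered at `f`. -/
def inva (ρ : ℝ) (f p : Pt) : Pt :=
  f + (ρ ^ 2 / ((p.1 - f.1) ^ 2 + (p.2 - f.2) ^ 2)) • (p - f)

/-- Unsigned area of a triangle. -/
def area (A B C : Pt) : ℝ :=
  |(B.1 - A.1) * (C.2 - A.2) - (B.2 - A.2) * (C.1 - A.1)| / 2

/-- The point with barycentric coordinates wA : wB : wC w.r.t. triangle ABC. -/
def bary (wA wB wC : ℝ) (A B C : Pt) : Pt :=
  (wA + wB + wC)⁻¹ • (wA • A + wB • B + wC • C)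

/-- Side length a = |BC|. -/
def sA (A B C : Pt) : ℝ := dst B C
/-- Side length b = |CA|. -/
def sB (A B C : Pt) : ℝ := dst C A
/-- Side length c = |AB|. -/
def sC (A B C : Pt) : ℝ := dst A B

/-- Incenter X(1). -/
def incenter (A B C : Pt) : Pt := bary (sA A B C) (sB A B C) (sC A B C) A B C

/-- Barycenter (centroid) X(2). -/
def centroid (A B C : Pt) : Pt := bary 1 1 1 A B C

/-- Circumcenter X(3), via its barycentric coordinates a²(b²+c²−a²) : · : ·. -/
def circumcenter (A B C : Pt) : Pt :=
  bary (sA A B C ^ 2 * (sB A B C ^ 2 + sC A B C ^ 2 - sA A B C ^ 2))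
       (sB A B C ^ 2 * (sC A B C ^ 2 + sA A B C ^ 2 - sB A B C ^ 2))
       (sC A B C ^ 2 * (sA A B C ^ 2 + sB A B C ^ 2 - sC A B C ^ 2)) A B C

/-- Orthocenter X(4) = A + B + C − 2·(circumcenter). -/
def orthocenter (A B C : Pt) : Pt := A + B + C - (2 : ℝ) • circumcenter A B C

/-- Nine-point center X(5): midpoint of circumcenter and orthocenter. -/
def ninePointCenter (A B C : Pt) : Pt :=
  ((1 : ℝ) / 2) • (circumcenter A B C + orthocenter A B C)

/-- Gergonne point X(7), barycentrics 1/(b+c−a) : 1/(c+a−b) : 1/(a+b−c). -/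
def gergonne (A B C : Pt) : Pt :=
  bary (sB A B C + sC A B C - sA A B C)⁻¹
       (sC A B C + sA A B C - sB A B C)⁻¹
       (sA A B C + sB A B C - sC A B C)⁻¹ A B C

/-- Mittenpunkt X(9), barycentrics a(b+c−a) : b(c+a−b) : c(a+b−c). -/
def mittenpunkt (A B C : Pt) : Pt :=
  bary (sA A B C * (sB A B C + sC A B C - sA A B C))
       (sB A B C * (sC A B C + sA A B C - sB A B C))
       (sC A B C * (sA A B C + sB A B C - sC A B C)) A B C

/-- Feuerbach point X(11), barycentrics (b+c−a)(b−c)² : · : ·. -/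
def feuerbach (A B C : Pt) : Pt :=
  bary ((sB A B C + sC A B C - sA A B C) * (sB A B C - sC A B C) ^ 2)
       ((sC A B C + sA A B C - sB A B C) * (sC A B C - sA A B C) ^ 2)
       ((sA A B C + sB A B C - sC A B C) * (sA A B C - sB A B C) ^ 2) A B C

/-- Triangle center X(100), barycentrics a/(b−c) : b/(c−a) : c/(a−b). -/
def X100 (A B C : Pt) : Pt :=
  bary (sA A B C / (sB A B C - sC A B C))
       (sB A B C / (sC A B C - sA A B C))
       (sC A B C / (sA A B C - sB A B C)) A B C

/-- Orthogonal projection of `Q` onto the line through `A` and `B`. -/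
def projLine (Q A B : Pt) : Pt :=
  A + (dot (Q - A) (B - A) / dot (B - A) (B - A)) • (B - A)

/-- Unsigned area of the pedal triangle of `Q` w.r.t. triangle `A B C`. -/
def pedalArea (Q A B C : Pt) : ℝ :=
  area (projLine Q A B) (projLine Q B C) (projLine Q C A)

end BilliardInv

open BilliardInv Real

/-- Algebraic core over a field: the pairwise Joachimsthal relations force the symmetric ones. -/
lemma core_field {F : Type*} [Field F] (z1 z2 z3 m K : F)
    (n1 : z1 ≠ 0) (h12 : z1 ≠ z2) (h23 : z2 ≠ z3) (h31 : z3 ≠ z1)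
    (r12 : z1 ^ 2 + z2 ^ 2 - m * (z1 ^ 2 * z2 ^ 2 + 1) = 2 * K * z1 * z2)
    (r23 : z2 ^ 2 + z3 ^ 2 - m * (z2 ^ 2 * z3 ^ 2 + 1) = 2 * K * z2 * z3)
    (r31 : z3 ^ 2 + z1 ^ 2 - m * (z3 ^ 2 * z1 ^ 2 + 1) = 2 * K * z3 * z1) :
    z1 ^ 2 - m = z2 * z3 - m * z1 ^ 2 * z2 * z3 ∧
    z2 ^ 2 - m = z3 * z1 - m * z2 ^ 2 * z3 * z1 ∧
    z3 ^ 2 - m = z1 * z2 - m * z3 ^ 2 * z1 * z2 ∧ m ^ 2 - 1 = 2 * K := by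
  have f1 : z1 ^ 2 - m = z2 * z3 - m * z1 ^ 2 * z2 * z3 := by
    apply mul_left_cancel₀ (sub_ne_zero.2 h23)
    linear_combination z2 * r31 - z3 * r12
  have f2 : z2 ^ 2 - m = z3 * z1 - m * z2 ^ 2 * z3 * z1 := by
    apply mul_left_cancel₀ (sub_ne_zero.2 h31)
    linear_combination z3 * r12 - z1 * r23
  have f3 : z3 ^ 2 - m = z1 * z2 - m * z3 ^ 2 * z1 * z2 := by
    apply mul_left_cancel₀ (sub_ne_zero.2 h12)
    linear_combination z1 * r23 - z2 * r31
  have e1 : z1 + z2 + z3 = - m * (z1 * z2 * z3) := by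
    apply mul_left_cancel₀ (sub_ne_zero.2 h12)
    linear_combination f1 - f2
  have g1 : (z2 + z3) * (1 - m * z1 ^ 2) = 2 * K * z1 := by
    apply mul_left_cancel₀ (sub_ne_zero.2 h23)
    linear_combination r12 - r31
  refine ⟨f1, f2, f3, ?_⟩
  apply mul_left_cancel₀ n1
  linear_combination g1 - (1 - m * z1 ^ 2) * e1 - m * z1 * f1

/-- From the real pair relation to the complex one. -/
lemma pair_complex (u1 v1 u2 v2 m K : ℝ) (c1 : u1 ^ 2 + v1 ^ 2 = 1) (c2 : u2 ^ 2 + v2 ^ 2 = 1)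
    (r : u1 * u2 + v1 * v2 - m * (u1 * u2 - v1 * v2) = K) :
    (⟨u1, v1⟩ : ℂ) ^ 2 + (⟨u2, v2⟩ : ℂ) ^ 2 - (m : ℂ) *
      ((⟨u1, v1⟩ : ℂ) ^ 2 * (⟨u2, v2⟩ : ℂ) ^ 2 + 1) = 2 * (K : ℂ) * ⟨u1, v1⟩ * ⟨u2, v2⟩ := by
  have e : ∀ x y : ℝ, (⟨x, y⟩ : ℂ) = x + y * Complex.I := fun x y => Complex.mk_eq_add_mul_I x y
  have hI : Complex.I ^ 2 = -1 := Complex.I_sq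
  have c1' : (u1 : ℂ) ^ 2 + (v1 : ℂ) ^ 2 = 1 := by exact_mod_cast c1
  have c2' : (u2 : ℂ) ^ 2 + (v2 : ℂ) ^ 2 = 1 := by exact_mod_cast c2
  have r' : (u1 : ℂ) * u2 + v1 * v2 - m * (u1 * u2 - v1 * v2) = K := by exact_mod_cast r
  rw [e, e]
  obtain ⟨z1, hz1⟩ : ∃ z : ℂ, z = u1 + v1 * Complex.I := ⟨_, rfl⟩
  obtain ⟨z2, hz2⟩ : ∃ z : ℂ, z = u2 + v2 * Complex.I := ⟨_, rfl⟩
  obtain ⟨w1, hw1⟩ : ∃ z : ℂ, z = u1 - v1 * Complex.I := ⟨_, rfl⟩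
  obtain ⟨w2, hw2⟩ : ∃ z : ℂ, z = u2 - v2 * Complex.I := ⟨_, rfl⟩
  have p1 : z1 * w1 = 1 := by rw [hz1, hw1]; linear_combination c1' - v1 ^ 2 * hI
  have p2 : z2 * w2 = 1 := by rw [hz2, hw2]; linear_combination c2' - v2 ^ 2 * hI
  have q : z1 * w2 + w1 * z2 - m * (z1 * z2 + w1 * w2) = 2 * K := by
    rw [hz1, hw1, hz2, hw2]
    linear_combination 2 * r' - 2 * v1 * v2 * (1 + m) * hI
  rw [← hz1, ← hz2]
  linear_combination z1 * z2 * q - z1 ^ 2 * p2 - z2 ^ 2 * p1 + m * z1 * w1 * p2 + m * p1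

/-- Consequence in real coordinates. -/
lemma core_real (u1 v1 u2 v2 u3 v3 m K : ℝ)
    (c1 : u1 ^ 2 + v1 ^ 2 = 1) (c2 : u2 ^ 2 + v2 ^ 2 = 1) (c3 : u3 ^ 2 + v3 ^ 2 = 1)
    (h12 : (u1, v1) ≠ (u2, v2)) (h23 : (u2, v2) ≠ (u3, v3)) (h31 : (u3, v3) ≠ (u1, v1))
    (r12 : u1 * u2 + v1 * v2 - m * (u1 * u2 - v1 * v2) = K)
    (r23 : u2 * u3 + v2 * v3 - m * (u2 * u3 - v2 * v3) = K)
    (r31 : u3 * u1 + v3 * v1 - m * (u3 * u1 - v3 * v1) = K) :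
    m ^ 2 - 1 = 2 * K ∧ ∃ p q : ℝ, p ^ 2 + q ^ 2 = 1 ∧
      2 * u1 ^ 2 = (1 - m) * p * u1 + (1 + m) * q * v1 + (1 + m) ∧
      2 * u2 ^ 2 = (1 - m) * p * u2 + (1 + m) * q * v2 + (1 + m) ∧
      2 * u3 ^ 2 = (1 - m) * p * u3 + (1 + m) * q * v3 + (1 + m) := by
  have ne : ∀ x y x' y' : ℝ, (x, y) ≠ (x', y') → (⟨x, y⟩ : ℂ) ≠ ⟨x', y'⟩ := by
    intro x y x' y' h h'
    apply h
    rw [Complex.mk.injEq] at h'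
    rw [h'.1, h'.2]
  have n1 : (⟨u1, v1⟩ : ℂ) ≠ 0 := by
    intro h
    have h1 := congrArg Complex.re h
    have h2 := congrArg Complex.im h
    simp at h1 h2
    rw [h1, h2] at c1
    norm_num at c1
  obtain ⟨f1, f2, f3, hK⟩ := core_field _ _ _ (m : ℂ) (K : ℂ) n1 (ne _ _ _ _ h12) (ne _ _ _ _ h23)
    (ne _ _ _ _ h31) (pair_complex _ _ _ _ _ _ c1 c2 r12) (pair_complex _ _ _ _ _ _ c2 c3 r23)
    (pair_complex _ _ _ _ _ _ c3 c1 r31)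
  refine ⟨by exact_mod_cast hK, ?_⟩
  have g1 := congrArg Complex.re f1
  have g2 := congrArg Complex.re f2
  have g3 := congrArg Complex.re f3
  simp [pow_two] at g1 g2 g3
  refine ⟨(u1 * u2 - v1 * v2) * u3 - (u1 * v2 + v1 * u2) * v3,
    (u1 * u2 - v1 * v2) * v3 + (u1 * v2 + v1 * u2) * u3, ?_, ?_, ?_, ?_⟩
  · have : ((u1 * u2 - v1 * v2) * u3 - (u1 * v2 + v1 * u2) * v3) ^ 2 +
      ((u1 * u2 - v1 * v2) * v3 + (u1 * v2 + v1 * u2) * u3) ^ 2 =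
      (u1 ^ 2 + v1 ^ 2) * (u2 ^ 2 + v2 ^ 2) * (u3 ^ 2 + v3 ^ 2) := by ring
    rw [this, c1, c2, c3]; norm_num
  · linear_combination g1 + (1 - (u2 * u3 - v2 * v3)) * c1
  · linear_combination g2 + (1 - (u1 * u3 - v1 * v3)) * c2
  · linear_combination g3 + (1 - (u1 * u2 - v1 * v2)) * c3

lemma dst_sq (p q : Pt) : dst p q ^ 2 = (p.1 - q.1) ^ 2 + (p.2 - q.2) ^ 2 := by
  unfold dst
  exact Real.sq_sqrt (by positivity)

lemma dst_comm' (p q : Pt) : dst p q = dst q p := by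
  unfold dst
  congr 1
  ring

lemma dst_pos' (p q : Pt) (h : p ≠ q) : 0 < dst p q := by
  unfold dst
  apply Real.sqrt_pos.2
  rcases eq_or_ne p.1 q.1 with h1 | h1
  · have h2 : p.2 ≠ q.2 := fun h2 => h (Prod.ext h1 h2)
    have := sub_ne_zero.2 h2
    positivity
  · have := sub_ne_zero.2 h1
    positivity

/-- The barycentric circumcenter is the equidistant point. -/
lemma circumcenter_eq (A B C Y : Pt) (k : ℝ)
    (hdet : (B.1 - A.1) * (C.2 - A.2) - (B.2 - A.2) * (C.1 - A.1) ≠ 0)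
    (hA : A.1 ^ 2 + A.2 ^ 2 - 2 * (Y.1 * A.1 + Y.2 * A.2) = k)
    (hB : B.1 ^ 2 + B.2 ^ 2 - 2 * (Y.1 * B.1 + Y.2 * B.2) = k)
    (hC : C.1 ^ 2 + C.2 ^ 2 - 2 * (Y.1 * C.1 + Y.2 * C.2) = k) :
    circumcenter A B C = Y := by
  obtain ⟨a1, a2⟩ := A
  obtain ⟨b1, b2⟩ := B
  obtain ⟨c1, c2⟩ := C
  obtain ⟨y1, y2⟩ := Y
  simp only at hdet hA hB hC
  unfold circumcenter bary sA sB sC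
  simp only [dst_sq]
  obtain ⟨D, hD⟩ : ∃ D, D = (b1 - a1) * (c2 - a2) - (b2 - a2) * (c1 - a1) := ⟨_, rfl⟩
  rw [← hD] at hdet
  have e1 : 2 * D * y1 = (a1 ^ 2 + a2 ^ 2) * (b2 - c2) + (b1 ^ 2 + b2 ^ 2) * (c2 - a2)
      + (c1 ^ 2 + c2 ^ 2) * (a2 - b2) := by
    rw [hD]
    linear_combination -(b2 - c2) * hA - (c2 - a2) * hB - (a2 - b2) * hC
  have e2 : 2 * D * y2 = -((a1 ^ 2 + a2 ^ 2) * (b1 - c1) + (b1 ^ 2 + b2 ^ 2) * (c1 - a1)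
      + (c1 ^ 2 + c2 ^ 2) * (a1 - b1)) := by
    rw [hD]
    linear_combination (b1 - c1) * hA + (c1 - a1) * hB + (a1 - b1) * hC
  ext
  · simp only [Prod.smul_fst, Prod.fst_add, smul_eq_mul]
    rw [inv_mul_eq_iff_eq_mul₀]
    · trans 2 * D * (2 * D * y1)
      · rw [e1, hD]; ring
      · rw [hD]; ring
    · have : 4 * D ^ 2 ≠ 0 := by positivity
      convert this using 1
      rw [hD]; ring
  · simp only [Prod.smul_snd, Prod.snd_add, smul_eq_mul]
    rw [inv_mul_eq_iff_eq_mul₀]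
    · trans 2 * D * (2 * D * y2)
      · rw [e2, hD]; ring
      · rw [hD]; ring
    · have : 4 * D ^ 2 ≠ 0 := by positivity
      convert this using 1
      rw [hD]; ring

/-- Dot product of a unit chord direction with the normal. -/
lemma dot_udir (a b : ℝ) (ha : 0 < a) (hb : 0 < b) (u v u' v' : ℝ) (h : u ^ 2 + v ^ 2 = 1) :
    dot (udir (a * u, b * v) (a * u', b * v')) (nrm a b (a * u, b * v)) =
      - ((1 - u * u' - v * v') / dst (a * u, b * v) (a * u', b * v')) := by
  unfold udir dot nrm
  simp only [Prod.smul_fst, Prod.smul_snd, Prod.fst_sub, Prod.snd_sub, smul_eq_mul]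
  generalize (dst (a * u, b * v) (a * u', b * v')) = d
  rw [div_eq_mul_inv]
  field_simp
  linear_combination -d⁻¹ * h

lemma pair_rel (a b : ℝ) (ha : 0 < a) (hb : 0 < b) (u v u' v' k : ℝ) (h : u ^ 2 + v ^ 2 = 1)
    (h' : u' ^ 2 + v' ^ 2 = 1) (hne : (u, v) ≠ (u', v'))
    (hk : (1 - u * u' - v * v') / dst (a * u, b * v) (a * u', b * v') = k) :
    u * u' + v * v' - (k ^ 2 * (a ^ 2 - b ^ 2)) * (u * u' - v * v') =
      1 - k ^ 2 * (a ^ 2 + b ^ 2) := by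
  have hd := dst_pos' (a * u, b * v) (a * u', b * v') (by
    intro e
    rw [Prod.mk.injEq] at e
    apply hne
    rw [mul_left_cancel₀ ha.ne' e.1, mul_left_cancel₀ hb.ne' e.2])
  have hs := dst_sq (a * u, b * v) (a * u', b * v')
  simp only at hs
  rw [div_eq_iff hd.ne'] at hk
  have hw : 1 - u * u' - v * v' ≠ 0 := by
    intro e
    have : (u - u') ^ 2 + (v - v') ^ 2 = 0 := by linear_combination h + h' + 2 * e
    have h1 : u - u' = 0 := by nlinarith [sq_nonneg (u - u'), sq_nonneg (v - v')]
    have h2 : v - v' = 0 := by nlinarith [sq_nonneg (u - u'), sq_nonneg (v - v')]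
    exact hne (by rw [sub_eq_zero.1 h1, sub_eq_zero.1 h2])
  have key : (1 - u * u' - v * v') ^ 2 = k ^ 2 * ((a * u - a * u') ^ 2 + (b * v - b * v') ^ 2) := by
    rw [← hs, hk]; ring
  have d1 : (u - u') ^ 2 = (1 - u * u' - v * v') * (1 - u * u' + v * v') := by
    have : v ^ 2 = 1 - u ^ 2 := by linarith
    have h2 : v' ^ 2 = 1 - u' ^ 2 := by linarith
    linear_combination v ^ 2 * h2 + (1 - u' ^ 2) * this
  have d2 : (v - v') ^ 2 = (1 - u * u' - v * v') * (1 + u * u' - v * v') := by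
    have : u ^ 2 = 1 - v ^ 2 := by linarith
    have h2 : u' ^ 2 = 1 - v' ^ 2 := by linarith
    linear_combination u ^ 2 * h2 + (1 - v' ^ 2) * this
  apply mul_left_cancel₀ hw
  linear_combination -key - k ^ 2 * a ^ 2 * d1 - k ^ 2 * b ^ 2 * d2

/-- The circle identity for the parametrised circumcenter. -/
lemma circle_identity (a b c δ p q τ : ℝ) (ha : 0 < a) (hb : 0 < b)
    (hc : c ^ 2 = a ^ 2 - b ^ 2) (hδ : δ ^ 2 = a ^ 4 - a ^ 2 * b ^ 2 + b ^ 4)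
    (hpq : p ^ 2 + q ^ 2 = 1) (hτ : a * τ = a * b ^ 2 - (a ^ 2 - δ) * (a + c * p)) :
    (2 * a * b ^ 4 * c + b ^ 4 * (a ^ 2 - δ) * p - a * τ * (c * (a ^ 2 + b ^ 2))) ^ 2
      + (a * b ^ 3 * (δ - b ^ 2) * q) ^ 2 = (a * (δ - b ^ 2) * (a * τ)) ^ 2 := by
  rw [hτ]
  have hq : q ^ 2 = 1 - p ^ 2 := by linarith
  have h0 : (a * b ^ 3 * (δ - b ^ 2) * q) ^ 2 = (a * b ^ 3 * (δ - b ^ 2)) ^ 2 * (1 - p ^ 2) := by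
    rw [← hq]; ring
  rw [h0]
  grind

lemma tau_pos (a b c δ p : ℝ) (ha : 0 < a) (hb : 0 < b) (hab : b < a) (hc0 : 0 < c) (hδ0 : 0 < δ)
    (hc : c ^ 2 = a ^ 2 - b ^ 2) (hδ : δ ^ 2 = a ^ 4 - a ^ 2 * b ^ 2 + b ^ 4)
    (hp : p ≤ 1) : 0 < a * b ^ 2 - (a ^ 2 - δ) * (a + c * p) := by
  have hca : c ^ 2 < a ^ 2 := by rw [hc]; nlinarith
  have h1 : c ^ 3 < a * δ := by
    apply lt_of_pow_lt_pow_left₀ 2 (by positivity)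
    have e1 : (c ^ 3) ^ 2 = (a ^ 2 - b ^ 2) ^ 3 := by rw [← hc]; ring
    have e2 : (a * δ) ^ 2 = a ^ 2 * (a ^ 4 - a ^ 2 * b ^ 2 + b ^ 4) := by rw [← hδ]; ring
    rw [e1, e2]
    have : 0 < a ^ 2 * b ^ 2 * (a ^ 2 - b ^ 2) := by rw [← hc]; positivity
    have : 0 < b ^ 6 := by positivity
    nlinarith
  have h2 : c ^ 2 * (a + c * p) < a * (a ^ 2 + δ) := by
    have : c ^ 3 * p ≤ c ^ 3 := by
      have : 0 < c ^ 3 := by positivity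
      nlinarith
    nlinarith
  have h3 : (a ^ 2 + δ) * (a * b ^ 2 - (a ^ 2 - δ) * (a + c * p)) =
      b ^ 2 * (a * (a ^ 2 + δ) - c ^ 2 * (a + c * p)) := by
    linear_combination (a + c * p) * hδ + b ^ 2 * (a + c * p) * hc
  have h4 : 0 < (a ^ 2 + δ) * (a * b ^ 2 - (a ^ 2 - δ) * (a + c * p)) := by
    rw [h3]
    have : 0 < a * (a ^ 2 + δ) - c ^ 2 * (a + c * p) := by linarith
    positivity
  exact pos_of_mul_pos_right h4 (by positivity) 

lemma det_ne (u1 v1 u2 v2 u3 v3 : ℝ)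
    (c1 : u1 ^ 2 + v1 ^ 2 = 1) (c2 : u2 ^ 2 + v2 ^ 2 = 1) (c3 : u3 ^ 2 + v3 ^ 2 = 1)
    (h12 : (u1, v1) ≠ (u2, v2)) (h23 : (u2, v2) ≠ (u3, v3)) (h31 : (u3, v3) ≠ (u1, v1)) :
    (u2 - u1) * (v3 - v1) - (v2 - v1) * (u3 - u1) ≠ 0 := by
  intro h
  have n12 : dst (u1, v1) (u2, v2) ^ 2 ≠ 0 := pow_ne_zero _ (dst_pos' _ _ h12).ne'
  have n23 : dst (u2, v2) (u3, v3) ^ 2 ≠ 0 := pow_ne_zero _ (dst_pos' _ _ h23).ne'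
  have n31 : dst (u3, v3) (u1, v1) ^ 2 ≠ 0 := pow_ne_zero _ (dst_pos' _ _ h31).ne'
  rw [dst_sq] at n12 n23 n31
  simp only at n12 n23 n31
  have : ((u1 - u2) ^ 2 + (v1 - v2) ^ 2) * ((u2 - u3) ^ 2 + (v2 - v3) ^ 2) *
    ((u3 - u1) ^ 2 + (v3 - v1) ^ 2) =
      4 * ((u2 - u1) * (v3 - v1) - (v2 - v1) * (u3 - u1)) ^ 2 := by
    grind
  rw [h] at this
  have := mul_ne_zero (mul_ne_zero n12 n23) n31
  simp_all

/-- One vertex: the inverted point lies on the circle centred at `Y`. -/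
lemma vertex_eq (a b c δ p q τ ρ u v : ℝ) (ha : 0 < a) (hb : 0 < b) (hτ0 : τ ≠ 0)
    (hd : a + c * u ≠ 0)
    (hc : c ^ 2 = a ^ 2 - b ^ 2) (hτ : a * τ = a * b ^ 2 - (a ^ 2 - δ) * (a + c * p))
    (hu : u ^ 2 + v ^ 2 = 1)
    (hs : c ^ 2 * u ^ 2 = (a ^ 2 - δ) * p * u + (δ - b ^ 2) * q * v + (δ - b ^ 2)) :
    (ρ ^ 2 * (a * u + c) / (a + c * u) ^ 2) ^ 2 + (ρ ^ 2 * (b * v) / (a + c * u) ^ 2) ^ 2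
     - 2 * (-ρ ^ 2 * (c + (a ^ 2 - δ) * p / (2 * a)) / τ * (ρ ^ 2 * (a * u + c) / (a + c * u) ^ 2)
        + -ρ ^ 2 * ((δ - b ^ 2) * q / (2 * b)) / τ * (ρ ^ 2 * (b * v) / (a + c * u) ^ 2))
     = ρ ^ 4 / τ := by
  have e : (a * u + c) ^ 2 + (b * v) ^ 2 = (a + c * u) ^ 2 := by
    have : v ^ 2 = 1 - u ^ 2 := by linarith
    linear_combination b ^ 2 * this + (1 - u ^ 2) * hc
  have e1 : (ρ ^ 2 * (a * u + c) / (a + c * u) ^ 2) ^ 2 + (ρ ^ 2 * (b * v) / (a + c * u) ^ 2) ^ 2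
     = ρ ^ 4 / (a + c * u) ^ 2 := by
    rw [div_pow, div_pow, ← add_div]
    have : (ρ ^ 2 * (a * u + c)) ^ 2 + (ρ ^ 2 * (b * v)) ^ 2 = ρ ^ 4 * (a + c * u) ^ 2 := by
      rw [← e]; ring
    rw [this]
    field_simp
  rw [e1]
  have main : a * τ + 2 * a * c * (a * u + c) + (a ^ 2 - δ) * p * (a * u + c)
      + a * (δ - b ^ 2) * q * v = a * (a + c * u) ^ 2 := by
    linear_combination hτ - a * hs + 2 * a * hc
  have h2 : τ + (2 * c + (a ^ 2 - δ) * p / a) * (a * u + c)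
      + (δ - b ^ 2) * q * v = (a + c * u) ^ 2 := by
    field_simp
    linear_combination main
  generalize (a + c * u) = d at *
  have h3 : (2 * c + (a ^ 2 - δ) * p / a) = 2 * (c + (a ^ 2 - δ) * p / (2 * a)) := by
    field_simp
  rw [h3] at h2
  generalize (c + (a ^ 2 - δ) * p / (2 * a)) = g at *
  field_simp
  linear_combination ρ ^ 4 * h2

set_option maxHeartbeats 2000000 in
/-- over the 3-periodic billiard family, the circumcenter X(3) of the
focus-inversive triangle lies on the stated circle. -/
theorem focus_inversive_circumcenter_circle (a b ρ : ℝ) (hab : a > b) (hb : b > 0)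
    (hρ : ρ > 0) (T : Orbit3 a b) :
    let c : ℝ := Real.sqrt (a ^ 2 - b ^ 2)
    let δ : ℝ := Real.sqrt (a ^ 4 - a ^ 2 * b ^ 2 + b ^ 4)
    let f1 : Pt := (-c, 0)
    let Ctr : Pt := (-c * (1 + ρ ^ 2 * (a ^ 2 + b ^ 2) / (2 * b ^ 4)), 0)
    dst (circumcenter (inva ρ f1 T.P1) (inva ρ f1 T.P2) (inva ρ f1 T.P3)) Ctr =
      ρ ^ 2 * a * (δ - b ^ 2) / (2 * b ^ 4) := by
  intro c δ f1 Ctr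
  have ha : 0 < a := hb.trans hab
  have hb2 : b ^ 2 < a ^ 2 := by nlinarith
  have hc : c ^ 2 = a ^ 2 - b ^ 2 := Real.sq_sqrt (by linarith)
  have hc0 : 0 < c := Real.sqrt_pos.2 (by linarith)
  have hpos : 0 < a ^ 4 - a ^ 2 * b ^ 2 + b ^ 4 := by
    have : 0 < a ^ 2 * (a ^ 2 - b ^ 2) := mul_pos (by positivity) (by linarith)
    have : 0 < b ^ 4 := by positivity
    nlinarith
  have hδ : δ ^ 2 = a ^ 4 - a ^ 2 * b ^ 2 + b ^ 4 := Real.sq_sqrt hpos.le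
  have hδ0 : 0 < δ := Real.sqrt_pos.2 hpos
  have hδb : b ^ 2 ≤ δ := by
    apply le_of_sq_le_sq _ hδ0.le
    rw [hδ]
    have : 0 < a ^ 2 * (a ^ 2 - b ^ 2) := mul_pos (by positivity) (by linarith)
    nlinarith
  clear_value c δ
  obtain ⟨P1, P2, P3, h1, h2, h3, d12, d23, d31, r1, r2, r3⟩ := T
  have par : ∀ P : Pt, onEllipse a b P → ∃ u v : ℝ, P = (a * u, b * v) ∧ u ^ 2 + v ^ 2 = 1 := by
    intro P hP
    refine ⟨P.1 / a, P.2 / b, ?_, ?_⟩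
    · ext
      · simp only; field_simp
      · simp only; field_simp
    · unfold onEllipse at hP
      rw [div_pow, div_pow]; exact hP
  obtain ⟨u1, v1, rfl, c1⟩ := par P1 h1
  obtain ⟨u2, v2, rfl, c2⟩ := par P2 h2
  obtain ⟨u3, v3, rfl, c3⟩ := par P3 h3
  have nn : ∀ u v u' v' : ℝ, ((a * u, b * v) : Pt) ≠ (a * u', b * v') → (u, v) ≠ (u', v') := by
    intro u v u' v' h e
    rw [Prod.mk.injEq] at e
    exact h (by rw [e.1, e.2])
  have n12 := nn _ _ _ _ d12
  have n23 := nn _ _ _ _ d23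
  have n31 := nn _ _ _ _ d31
  unfold reflectAt at r1 r2 r3
  rw [dot_udir a b ha hb _ _ _ _ c1, dot_udir a b ha hb _ _ _ _ c1, neg_inj] at r1
  rw [dot_udir a b ha hb _ _ _ _ c2, dot_udir a b ha hb _ _ _ _ c2, neg_inj] at r2
  obtain ⟨k, hk⟩ : ∃ k, (1 - u1 * u2 - v1 * v2) / dst (a * u1, b * v1) (a * u2, b * v2) = k :=
    ⟨_, rfl⟩
  rw [hk] at r1
  have r2' : (1 - u2 * u3 - v2 * v3) / dst (a * u2, b * v2) (a * u3, b * v3) = k := by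
    rw [← r2, ← hk, dst_comm' (a * u2, b * v2)]
    ring_nf
  have r1' : (1 - u3 * u1 - v3 * v1) / dst (a * u3, b * v3) (a * u1, b * v1) = k := by
    rw [← r1, dst_comm' (a * u3, b * v3)]
    ring_nf
  obtain ⟨hK, p, q, hpq, s1, s2, s3⟩ := core_real u1 v1 u2 v2 u3 v3 (k ^ 2 * (a ^ 2 - b ^ 2))
    (1 - k ^ 2 * (a ^ 2 + b ^ 2)) c1 c2 c3 n12 n23 n31
    (pair_rel a b ha hb _ _ _ _ _ c1 c2 n12 hk)
    (pair_rel a b ha hb _ _ _ _ _ c2 c3 n23 r2')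
    (pair_rel a b ha hb _ _ _ _ _ c3 c1 n31 r1')
  rw [← hc] at hK s1 s2 s3
  have hm : k ^ 2 * c ^ 4 + a ^ 2 + b ^ 2 = 2 * δ := by
    rw [← sq_eq_sq₀ (by positivity) (by positivity)]
    have h4 : (c ^ 2) ^ 2 = (a ^ 2 - b ^ 2) ^ 2 := by rw [hc]
    linear_combination c ^ 4 * hK + 3 * h4 - 4 * hδ
  have key : ∀ u v : ℝ, 2 * u ^ 2 = (1 - k ^ 2 * c ^ 2) * p * u + (1 + k ^ 2 * c ^ 2) * q * v +
      (1 + k ^ 2 * c ^ 2) →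
      c ^ 2 * u ^ 2 = (a ^ 2 - δ) * p * u + (δ - b ^ 2) * q * v + (δ - b ^ 2) := by
    intro u v h
    linear_combination c ^ 2 / 2 * h + (- p * u + q * v + 1) / 2 * hm
      + (p * u + q * v + 1) / 2 * hc
  have t1 := key _ _ s1
  have t2 := key _ _ s2
  have t3 := key _ _ s3
  have hp : p ≤ 1 := by nlinarith [sq_nonneg q]
  have tp := tau_pos a b c δ p ha hb hab hc0 hδ0 hc hδ hp
  obtain ⟨τ, hτ⟩ : ∃ τ, a * τ = a * b ^ 2 - (a ^ 2 - δ) * (a + c * p) :=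
    ⟨(a * b ^ 2 - (a ^ 2 - δ) * (a + c * p)) / a, by field_simp⟩
  have hτ0 : 0 < τ := by
    rw [← hτ] at tp
    exact pos_of_mul_pos_right tp ha.le 
  have hca : c < a := lt_of_pow_lt_pow_left₀ 2 ha.le (by linarith [pow_pos hb 2])
  have dpos : ∀ u v : ℝ, u ^ 2 + v ^ 2 = 1 → 0 < a + c * u := by
    intro u v h
    have : -1 ≤ u := by nlinarith [sq_nonneg v]
    nlinarith
  have hinv : ∀ u v : ℝ, u ^ 2 + v ^ 2 = 1 → inva ρ f1 (a * u, b * v) =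
      f1 + (ρ ^ 2 * (a * u + c) / (a + c * u) ^ 2, ρ ^ 2 * (b * v) / (a + c * u) ^ 2) := by
    intro u v h
    have e : (a * u - -c) ^ 2 + (b * v - 0) ^ 2 = (a + c * u) ^ 2 := by
      have : v ^ 2 = 1 - u ^ 2 := by linarith
      linear_combination b ^ 2 * this + (1 - u ^ 2) * hc
    unfold inva
    simp only [f1, e]
    ext
    · simp; ring
    · simp; ring
  rw [hinv _ _ c1, hinv _ _ c2, hinv _ _ c3]
  have w1 := vertex_eq a b c δ p q τ ρ u1 v1 ha hb hτ0.ne' (dpos _ _ c1).ne' hc hτ c1 t1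
  have w2 := vertex_eq a b c δ p q τ ρ u2 v2 ha hb hτ0.ne' (dpos _ _ c2).ne' hc hτ c2 t2
  have w3 := vertex_eq a b c δ p q τ ρ u3 v3 ha hb hτ0.ne' (dpos _ _ c3).ne' hc hτ c3 t3
  have hdet := det_ne _ _ _ _ _ _ c1 c2 c3 n12 n23 n31
  have hD : (ρ ^ 2 * (a * u2 + c) / (a + c * u2) ^ 2 - ρ ^ 2 * (a * u1 + c) / (a + c * u1) ^ 2) *
      (ρ ^ 2 * (b * v3) / (a + c * u3) ^ 2 - ρ ^ 2 * (b * v1) / (a + c * u1) ^ 2) -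
      (ρ ^ 2 * (b * v2) / (a + c * u2) ^ 2 - ρ ^ 2 * (b * v1) / (a + c * u1) ^ 2) *
      (ρ ^ 2 * (a * u3 + c) / (a + c * u3) ^ 2 - ρ ^ 2 * (a * u1 + c) / (a + c * u1) ^ 2) ≠ 0 := by
    have x1 := (dpos _ _ c1).ne'
    have x2 := (dpos _ _ c2).ne'
    have x3 := (dpos _ _ c3).ne'
    have D1 : ∀ u v : ℝ, c ^ 2 * u ^ 2 = (a ^ 2 - δ) * p * u + (δ - b ^ 2) * q * v + (δ - b ^ 2) →
      (a + c * u) ^ 2 = (a ^ 2 + δ - b ^ 2) + (2 * a * c + (a ^ 2 - δ) * p) * u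
        + (δ - b ^ 2) * q * v := by
      intro u v h
      linear_combination h
    have z1 := D1 _ _ t1
    have z2 := D1 _ _ t2
    have z3 := D1 _ _ t3
    have : ∀ A1 A2 A3 B1 B2 B3 d1 d2 d3 : ℝ, d1 ≠ 0 → d2 ≠ 0 → d3 ≠ 0 →
      (ρ ^ 2 * A2 / d2 - ρ ^ 2 * A1 / d1) * (ρ ^ 2 * B3 / d3 - ρ ^ 2 * B1 / d1) -
      (ρ ^ 2 * B2 / d2 - ρ ^ 2 * B1 / d1) * (ρ ^ 2 * A3 / d3 - ρ ^ 2 * A1 / d1) =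
      ρ ^ 4 / (d1 * d2 * d3) * (d1 * (A2 * B3 - A3 * B2) + d2 * (A3 * B1 - A1 * B3)
        + d3 * (A1 * B2 - A2 * B1)) := by
      intro A1 A2 A3 B1 B2 B3 d1 d2 d3 h1 h2 h3
      field_simp
      ring
    rw [this _ _ _ _ _ _ _ _ _ (pow_ne_zero 2 x1) (pow_ne_zero 2 x2) (pow_ne_zero 2 x3)]
    have fin : (a + c * u1) ^ 2 * ((a * u2 + c) * (b * v3) - (a * u3 + c) * (b * v2))
      + (a + c * u2) ^ 2 * ((a * u3 + c) * (b * v1) - (a * u1 + c) * (b * v3))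
      + (a + c * u3) ^ 2 * ((a * u1 + c) * (b * v2) - (a * u2 + c) * (b * v1))
      = b * (a * τ) * ((u2 - u1) * (v3 - v1) - (v2 - v1) * (u3 - u1)) := by
      rw [z1, z2, z3]
      have hτ' : a * τ = a * (a ^ 2 + δ - b ^ 2) - c * (2 * a * c + (a ^ 2 - δ) * p) := by
        linear_combination hτ + 2 * a * hc
      rw [hτ']
      ring
    rw [fin]
    have : ρ ^ 4 / ((a + c * u1) ^ 2 * (a + c * u2) ^ 2 * (a + c * u3) ^ 2) ≠ 0 := by positivity
    exact mul_ne_zero this (mul_ne_zero (by positivity) hdet)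
  obtain ⟨Y1, hY1⟩ : ∃ Y1, Y1 = -ρ ^ 2 * (c + (a ^ 2 - δ) * p / (2 * a)) / τ := ⟨_, rfl⟩
  obtain ⟨Y2, hY2⟩ : ∃ Y2, Y2 = -ρ ^ 2 * ((δ - b ^ 2) * q / (2 * b)) / τ := ⟨_, rfl⟩
  rw [← hY1, ← hY2] at w1 w2 w3
  rw [circumcenter_eq _ _ _ (f1 + (Y1, Y2)) (ρ ^ 4 / τ - c ^ 2 + 2 * c * Y1)]
  · have R0 : 0 ≤ ρ ^ 2 * a * (δ - b ^ 2) / (2 * b ^ 4) := by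
      have : 0 ≤ δ - b ^ 2 := by linarith
      positivity
    rw [← sq_eq_sq₀ (show 0 ≤ dst _ _ from Real.sqrt_nonneg _) R0, dst_sq]
    simp only [f1, Ctr, Prod.fst_add, Prod.snd_add]
    have ci := circle_identity a b c δ p q τ ha hb hc hδ hpq hτ
    have E1 : -c + Y1 - -c * (1 + ρ ^ 2 * (a ^ 2 + b ^ 2) / (2 * b ^ 4)) =
        -ρ ^ 2 / (2 * a * b ^ 4 * τ) *
        (2 * a * b ^ 4 * c + b ^ 4 * (a ^ 2 - δ) * p - a * τ * (c * (a ^ 2 + b ^ 2))) := by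
      rw [hY1]; field_simp; ring
    have E2 : 0 + Y2 - 0 = -ρ ^ 2 / (2 * a * b ^ 4 * τ) * (a * b ^ 3 * (δ - b ^ 2) * q) := by
      rw [hY2]; field_simp; ring
    rw [E1, E2, mul_pow, mul_pow, ← mul_add, ci]
    field_simp
  · simp only [f1, Prod.fst_add, Prod.snd_add]
    convert hD using 1
    ring
  · simp only [f1, Prod.fst_add, Prod.snd_add]
    linear_combination w1
  · simp only [f1, Prod.fst_add, Prod.snd_add]
    linear_combination w2
  · simp only [f1, Prod.fst_add, Prod.snd_add]
    linear_combination w3
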